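/- arXiv:2111.06380 — 3 statements merged into one kernel-verified Lean document; each statement's English description precedes it below -/
import Mathlib

section
/- Let (X, h, Z) be a fiberwise essentially minimal zero-dimensional system with associated map ψ : X → Z, and let f : X → ℤ be a continuous function such that f(x) ≥ f(h⁻¹(x)) for all x ∈ X. Then f ∘ h⁻¹ = f; moreover, f is constant on the fiber ψ⁻¹(z) for every z ∈ Z. -/
open Set

/-- A minimal set for the restriction of the homeomorphism `h` to the invariant set `A`:
a nonempty closed `h`-invariant subset of `A` with no nonempty proper closed
`h`-invariant subset. -/
def IsMinimalSubsetOf {X : Type*} [TopologicalSpace X] (h : X ≃ₜ X) (A Y : Set X) : Prop :=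
  Y.Nonempty ∧ IsClosed Y ∧ Y ⊆ A ∧ h '' Y = Y ∧
    ∀ Y' ⊆ Y, Y'.Nonempty → IsClosed Y' → h '' Y' = Y' → Y' = Y

/-- `(X, h, Z)` is a fiberwise essentially minimal zero-dimensional system with
associated map `ψ`. -/
def IsFiberwiseEssentiallyMinimal {X : Type*} [TopologicalSpace X] (h : X ≃ₜ X)
    (Z : Set X) (ψ : X → X) : Prop :=
  IsClosed Z ∧ Continuous ψ ∧ (∀ x, ψ x ∈ Z) ∧ (∀ z ∈ Z, ψ z = z) ∧
    (∀ x, ψ (h x) = ψ x) ∧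
    ∀ z ∈ Z, ∃ Y, IsMinimalSubsetOf h (ψ ⁻¹' {z}) Y ∧ z ∈ Y ∧
      ∀ Y', IsMinimalSubsetOf h (ψ ⁻¹' {z}) Y' → Y' = Y

/-- A nonempty closed forward-invariant subset of a compact space contains a minimal set. -/
theorem exists_isMinimalSubsetOf {X : Type*} [TopologicalSpace X] [CompactSpace X]
    (g : X ≃ₜ X) {A : Set X} (hne : A.Nonempty) (hcl : IsClosed A) (hmaps : g '' A ⊆ A) :
    ∃ Y, IsMinimalSubsetOf g A Y := by
  obtain ⟨Y, hYA, hY⟩ := zorn_superset_nonempty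
    {B : Set X | B.Nonempty ∧ IsClosed B ∧ g '' B ⊆ B} (by
      intro c hc hchain hcne
      have : Nonempty c := hcne.to_subtype
      refine ⟨⋂₀ c, ⟨?_, isClosed_sInter fun B hB ↦ (hc hB).2.1, ?_⟩,
        fun B hB ↦ sInter_subset_of_mem hB⟩
      · exact IsCompact.nonempty_sInter_of_directed_nonempty_isCompact_isClosed
          (fun B hB C hC ↦ (hchain.total hB hC).elim (fun hBC ↦ ⟨B, hB, subset_rfl, hBC⟩)
            fun hCB ↦ ⟨C, hC, hCB, subset_rfl⟩)
          (fun B hB ↦ (hc hB).1)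
          (fun B hB ↦ (hc hB).2.1.isCompact) (fun B hB ↦ (hc hB).2.1)
      · rintro _ ⟨x, hx, rfl⟩ B hB
        exact (hc hB).2.2 (mem_image_of_mem g (hx B hB))) A ⟨hne, hcl, hmaps⟩
  have hYmem := hY.prop
  refine ⟨Y, hYmem.1, hYmem.2.1, hYA, ?_, fun Y' hY' hne' hcl' hinv' ↦ ?_⟩
  · exact hY.eq_of_subset
      ⟨hYmem.1.image g, g.isClosedMap Y hYmem.2.1, image_mono hYmem.2.2⟩ hYmem.2.2
  · exact hY.eq_of_subset ⟨hne', hcl', hinv'.subset⟩ hY'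

theorem Homeomorph.symm_image_eq_self_iff {X : Type*} [TopologicalSpace X] (h : X ≃ₜ X)
    (Y : Set X) : h.symm '' Y = Y ↔ h '' Y = Y := by
  constructor <;> intro hY
  · conv_lhs => rw [← hY]
    simp [image_image]
  · conv_lhs => rw [← hY]
    simp [image_image]

theorem IsMinimalSubsetOf.of_symm {X : Type*} [TopologicalSpace X] {h : X ≃ₜ X} {A Y : Set X}
    (hY : IsMinimalSubsetOf h.symm A Y) : IsMinimalSubsetOf h A Y := by
  simpa only [IsMinimalSubsetOf, Homeomorph.symm_image_eq_self_iff] using hY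

theorem IsMinimalSubsetOf.mono {X : Type*} [TopologicalSpace X] {h : X ≃ₜ X} {A B Y : Set X}
    (hY : IsMinimalSubsetOf h A Y) (hAB : A ⊆ B) : IsMinimalSubsetOf h B Y :=
  ⟨hY.1, hY.2.1, hY.2.2.1.trans hAB, hY.2.2.2⟩

/-- On the fiber over `z`, a continuous function that is nondecreasing along orbits takes
only the value `f z`. -/
theorem IsFiberwiseEssentiallyMinimal.apply_eq {X : Type*} [TopologicalSpace X] [CompactSpace X]
    [T1Space X] {h : X ≃ₜ X} {Z : Set X} {ψ : X → X}
    (hfem : IsFiberwiseEssentiallyMinimal h Z ψ) {f : X → ℤ} (hf : Continuous f)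
    (hmono : ∀ x, f (h.symm x) ≤ f x) {z : X} (hz : z ∈ Z) {x : X} (hx : ψ x = z) :
    f x = f z := by
  obtain ⟨-, hψ, -, -, hψh, hmin⟩ := hfem
  obtain ⟨Y, -, hzY, huniq⟩ := hmin z hz
  have hF : IsClosed (ψ ⁻¹' {z}) := isClosed_singleton.preimage hψ
  apply le_antisymm
  · obtain ⟨Y', hY'⟩ := exists_isMinimalSubsetOf h (A := ψ ⁻¹' {z} ∩ {y | f x ≤ f y})
      ⟨x, hx, le_refl (f x)⟩ (hF.inter (isClosed_le continuous_const hf)) (by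
        rintro _ ⟨y, ⟨hy, hle⟩, rfl⟩
        exact ⟨(hψh y).trans hy, le_trans hle (by simpa using hmono (h y))⟩)
    rw [← huniq Y' (hY'.mono inter_subset_left)] at hzY
    exact (hY'.2.2.1 hzY).2
  · obtain ⟨Y', hY'⟩ := exists_isMinimalSubsetOf h.symm (A := ψ ⁻¹' {z} ∩ {y | f y ≤ f x})
      ⟨x, hx, le_refl (f x)⟩ (hF.inter (isClosed_le hf continuous_const)) (by
        rintro _ ⟨y, ⟨hy, hle⟩, rfl⟩
        have hψy : ψ (h.symm y) = ψ y := by simpa using (hψh (h.symm y)).symm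
        exact ⟨hψy.trans hy, (hmono y).trans hle⟩)
    rw [← huniq Y' (hY'.of_symm.mono inter_subset_left)] at hzY
    exact (hY'.2.2.1 hzY).2

/-- If `f : X → ℤ` is continuous and satisfies `f(x) ≥ f(h⁻¹(x))` for all `x`, then
`f ∘ h⁻¹ = f`, and `f` is constant on each fiber `ψ⁻¹(z)`. -/
theorem stmt2 {X : Type*} [TopologicalSpace X] [CompactSpace X] [TopologicalSpace.MetrizableSpace X]
    [TotallyDisconnectedSpace X] (h : X ≃ₜ X) (Z : Set X) (ψ : X → X)
    (hfem : IsFiberwiseEssentiallyMinimal h Z ψ)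
    (f : X → ℤ) (hf : Continuous f) (hmono : ∀ x : X, f (h.symm x) ≤ f x) :
    (f ∘ h.symm = f) ∧
      ∀ z ∈ Z, ∀ x ∈ ψ ⁻¹' {z}, ∀ y ∈ ψ ⁻¹' {z}, f x = f y := by
  have key : ∀ x, f x = f (ψ x) := fun x ↦ hfem.apply_eq hf hmono (hfem.2.2.1 x) rfl
  refine ⟨funext fun x ↦ ?_, fun z _ x hx y hy ↦ ?_⟩
  · have hψx : ψ (h.symm x) = ψ x := by simpa using (hfem.2.2.2.2.1 (h.symm x)).symm
    rw [Function.comp_apply, key, hψx, ← key]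
  · rw [key x, key y, show ψ x = z from hx, show ψ y = z from hy]
end

section
/- Let (X, h, Z) be a fiberwise essentially minimal zero-dimensional system. Let C(X, ℤ) denote the additive group of continuous functions X → ℤ, let α : C(X, ℤ) → C(X, ℤ) be the automorphism α(f) = f ∘ h⁻¹, let K⁰(X, h) = C(X, ℤ)/im(id − α) with quotient map π : C(X, ℤ) → K⁰(X, h), and let K⁰(X, h)⁺ = π({f ∈ C(X, ℤ) : f(x) ≥ 0 for all x ∈ X}). Then (K⁰(X, h), K⁰(X, h)⁺) is an ordered group and the class π(1) of the constant function 1 is an order unit; in particular, K⁰(X, h)⁺ ∩ (−K⁰(X, h)⁺) = {0}. -/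
open Set

/-- The additive group homomorphism `id - α` on `C(X, ℤ)`, where `α(f) = f ∘ h⁻¹`. -/
noncomputable def coboundary {X : Type*} [TopologicalSpace X] (h : X ≃ₜ X) :
    C(X, ℤ) →+ C(X, ℤ) where
  toFun f := f - f.comp (h.symm : C(X, X))
  map_zero' := by ext x; simp
  map_add' f g := by ext x; simp; ring

/-- `K⁰(X, h)`: the quotient of `C(X, ℤ)` by the image of `id - α`. -/
noncomputable def K0 {X : Type*} [TopologicalSpace X] (h : X ≃ₜ X) :=
  C(X, ℤ) ⧸ (coboundary h).range

noncomputable instance {X : Type*} [TopologicalSpace X] (h : X ≃ₜ X) :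
    AddCommGroup (K0 h) :=
  inferInstanceAs (AddCommGroup (C(X, ℤ) ⧸ (coboundary h).range))

/-- The quotient map `π : C(X, ℤ) → K⁰(X, h)`. -/
noncomputable def K0pi {X : Type*} [TopologicalSpace X] (h : X ≃ₜ X) :
    C(X, ℤ) →+ K0 h :=
  QuotientAddGroup.mk' (coboundary h).range

/-- The positive cone `K⁰(X, h)⁺`, the image of the pointwise nonnegative functions. -/
noncomputable def K0pos {X : Type*} [TopologicalSpace X] (h : X ≃ₜ X) : Set (K0 h) :=
  K0pi h '' { f : C(X, ℤ) | ∀ x, 0 ≤ f x }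

section Dynamics

variable {X : Type*} [TopologicalSpace X]

theorem Homeomorph.image_eq_self_iff {h : X ≃ₜ X} {C : Set X} :
    h '' C = C ↔ ∀ y, h y ∈ C ↔ y ∈ C := by
  rw [h.image_eq_preimage_symm, Set.ext_iff]
  constructor
  · intro H y
    simpa using (H (h y)).symm
  · intro H y
    simpa using (H (h.symm y)).symm

/-- A nonempty closed invariant subset of a compact space contains a minimal set. -/
theorem exists_isMinimalSubsetOf_subset [CompactSpace X] (h : X ≃ₜ X) {A C : Set X}
    (hCA : C ⊆ A) (hne : C.Nonempty) (hcl : IsClosed C) (hinv : h '' C = C) :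
    ∃ Y ⊆ C, IsMinimalSubsetOf h A Y := by
  obtain ⟨Y, hYC, hY⟩ := zorn_superset_nonempty
    {D : Set X | D.Nonempty ∧ IsClosed D ∧ h '' D = D} (by
      intro c hc hchain hcne
      refine ⟨⋂₀ c, ⟨?_, isClosed_sInter fun s hs => (hc hs).2.1, ?_⟩,
        fun s hs => sInter_subset_of_mem hs⟩
      · have : Nonempty c := hcne.to_subtype
        exact IsCompact.nonempty_sInter_of_directed_nonempty_isCompact_isClosed
          (fun s hs t ht => (hchain.total hs ht).elim
            (fun hst => ⟨s, hs, Subset.rfl, hst⟩) (fun hts => ⟨t, ht, hts, Subset.rfl⟩))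
          (fun s hs => (hc hs).1) (fun s hs => (hc hs).2.1.isCompact) (fun s hs => (hc hs).2.1)
      · rw [Homeomorph.image_eq_self_iff]
        intro y
        simp only [mem_sInter]
        exact forall₂_congr fun s hs => Homeomorph.image_eq_self_iff.1 (hc hs).2.2 y)
    C ⟨hne, hcl, hinv⟩
  refine ⟨Y, hYC, hY.prop.1, hY.prop.2.1, hYC.trans hCA, hY.prop.2.2, ?_⟩
  exact fun Y' hY' h1 h2 h3 => hY'.antisymm (hY.le_of_le ⟨h1, h2, h3⟩ hY')

theorem IsFiberwiseEssentiallyMinimal.mem_of_invariant [CompactSpace X] {h : X ≃ₜ X}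
    {Z : Set X} {ψ : X → X} (hfem : IsFiberwiseEssentiallyMinimal h Z ψ) {z : X} (hz : z ∈ Z)
    {C : Set X} (hC : C ⊆ ψ ⁻¹' {z}) (hne : C.Nonempty) (hcl : IsClosed C)
    (hinv : h '' C = C) : z ∈ C := by
  obtain ⟨Y, -, hzY, huniq⟩ := hfem.2.2.2.2.2 z hz
  obtain ⟨Y', hY'C, hY'⟩ := exists_isMinimalSubsetOf_subset h hC hne hcl hinv
  exact hY'C (huniq Y' hY' ▸ hzY)

/-- If `u` takes the constant value `M` on arbitrarily long orbit segments in the fiber over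
`z ∈ Z`, then `u z = M`. -/
theorem IsFiberwiseEssentiallyMinimal.apply_eq_of_orbit_segments [CompactSpace X] [T1Space X]
    {h : X ≃ₜ X} {Z : Set X} {ψ : X → X} (hfem : IsFiberwiseEssentiallyMinimal h Z ψ) {z : X}
    (hz : z ∈ Z) (u : C(X, ℤ)) (M : ℤ)
    (H : ∀ k : ℕ, ∃ y, ψ y = z ∧ ∀ n : ℤ, |n| ≤ k → u ((h ^ n) y) = M) : u z = M := by
  have hψ : Continuous ψ := hfem.2.1
  have hclosed : ∀ n : ℤ, IsClosed {y | u ((h ^ n) y) = M} := fun n =>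
    isClosed_eq (u.continuous.comp (h ^ n).continuous) continuous_const
  let t : ℕ → Set X := fun k => ψ ⁻¹' {z} ∩ {y | ∀ n : ℤ, |n| ≤ k → u ((h ^ n) y) = M}
  have ht : ∀ k, IsClosed (t k) := fun k => by
    refine (isClosed_singleton.preimage hψ).inter ?_
    simp only [ofPred_forall]
    exact isClosed_iInter fun n => isClosed_iInter fun _ => hclosed n
  let C : Set X := {y | ψ y = z ∧ ∀ n : ℤ, u ((h ^ n) y) = M}
  have hne : C.Nonempty := by
    obtain ⟨y, hy⟩ := IsCompact.nonempty_iInter_of_sequence_nonempty_isCompact_isClosed t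
      (fun k y hy => ⟨hy.1, fun n hn => hy.2 n (hn.trans (by push_cast; omega))⟩)
      (fun k => let ⟨y, h1, h2⟩ := H k; ⟨y, h1, h2⟩) (ht 0).isCompact ht
    rw [mem_iInter] at hy
    exact ⟨y, (hy 0).1, fun n => (hy n.natAbs).2 n (by simp)⟩
  have hcl : IsClosed C := by
    have hC : C = ψ ⁻¹' {z} ∩ ⋂ n : ℤ, {y | u ((h ^ n) y) = M} := by
      ext y
      simp [C]
    rw [hC]
    exact (isClosed_singleton.preimage hψ).inter (isClosed_iInter hclosed)
  have hinv : h '' C = C := by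
    rw [Homeomorph.image_eq_self_iff]
    intro y
    have hshift : ∀ n : ℤ, (h ^ n) (h y) = (h ^ (n + 1)) y := fun n => by
      rw [zpow_add_one]; rfl
    simp only [C, mem_ofPred_eq, hfem.2.2.2.2.1 y, hshift]
    refine and_congr_right fun _ => ⟨fun H n => ?_, fun H n => H _⟩
    simpa using H (n - 1)
  have := (hfem.mem_of_invariant hz (fun y hy => hy.1) hne hcl hinv).2 0
  simpa using this

/-- A continuous integer-valued function that is monotone along orbits is invariant. -/
theorem IsFiberwiseEssentiallyMinimal.apply_eq_of_le [CompactSpace X] [T1Space X]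
    {h : X ≃ₜ X} {Z : Set X} {ψ : X → X} (hfem : IsFiberwiseEssentiallyMinimal h Z ψ)
    (u : C(X, ℤ)) (hu : ∀ x, u x ≤ u (h x)) (x : X) : u (h x) = u x := by
  have hstep : ∀ n : ℤ, (h ^ (n + 1)) x = h ((h ^ n) x) := fun n => by
    rw [add_comm, zpow_one_add]; rfl
  have hmono : Monotone fun n : ℤ => u ((h ^ n) x) :=
    monotone_int_of_le_succ fun n => by
      change u _ ≤ u _
      rw [hstep]; exact hu _
  have hfib : ∀ n : ℤ, ψ ((h ^ n) x) = ψ x := fun n => by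
    induction n with
    | zero => simp
    | succ n ih => rw [hstep, hfem.2.2.2.2.1, ih]
    | pred n ih =>
      rw [← ih, ← hfem.2.2.2.2.1, ← hstep, sub_add_cancel]
  have hcomp : ∀ m n : ℤ, (h ^ n) ((h ^ m) x) = (h ^ (n + m)) x := fun m n => by
    rw [zpow_add]; rfl
  have hrange : IsCompact (range u) := isCompact_range u.continuous
  obtain ⟨b, hb⟩ := hrange.bddAbove
  obtain ⟨a, ha⟩ := hrange.bddBelow
  obtain ⟨M, ⟨N, hN⟩, hM⟩ := Int.exists_greatest_of_bdd
    (P := fun m => ∃ n : ℤ, u ((h ^ n) x) = m)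
    ⟨b, by rintro _ ⟨n, rfl⟩; exact hb (mem_range_self _)⟩ ⟨_, 0, rfl⟩
  obtain ⟨m, ⟨K, hK⟩, hm⟩ := Int.exists_least_of_bdd
    (P := fun m => ∃ n : ℤ, u ((h ^ n) x) = m)
    ⟨a, by rintro _ ⟨n, rfl⟩; exact ha (mem_range_self _)⟩ ⟨_, 0, rfl⟩
  have hzM : u (ψ x) = M :=
    hfem.apply_eq_of_orbit_segments (hfem.2.2.1 x) u M fun k =>
      ⟨(h ^ (N + k)) x, hfib _, fun n hn => by
        rw [hcomp]
        refine le_antisymm (hM _ ⟨_, rfl⟩) (hN ▸ hmono ?_)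
        have := neg_le_of_abs_le hn
        omega⟩
  have hzm : u (ψ x) = m :=
    hfem.apply_eq_of_orbit_segments (hfem.2.2.1 x) u m fun k =>
      ⟨(h ^ (K - k)) x, hfib _, fun n hn => by
        rw [hcomp]
        refine le_antisymm (hK ▸ hmono ?_) (hm _ ⟨_, rfl⟩)
        have := le_of_abs_le hn
        omega⟩
  have h1 := hM (u (h x)) ⟨1, by simp⟩
  have h2 := hm (u x) ⟨0, by simp⟩
  have h3 := hu x
  omega

end Dynamics

section K0

variable {X : Type*} [TopologicalSpace X]

theorem K0pi_surjective (h : X ≃ₜ X) : Function.Surjective (K0pi h) :=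
  QuotientAddGroup.mk'_surjective _

theorem K0pi_eq_zero_iff {h : X ≃ₜ X} {f : C(X, ℤ)} :
    K0pi h f = 0 ↔ ∃ u, coboundary h u = f :=
  QuotientAddGroup.eq_zero_iff f

theorem coboundary_apply (h : X ≃ₜ X) (u : C(X, ℤ)) (x : X) :
    coboundary h u x = u x - u (h.symm x) := rfl

theorem ContinuousMap.countable_int [CompactSpace X] [SecondCountableTopology X] [T2Space X] :
    Countable C(X, ℤ) := by
  have : DiscreteTopology C(X, ℤ) := DiscreteTopology.of_forall_le_dist one_pos fun f g hfg => by
    obtain ⟨x, hx⟩ := DFunLike.ne_iff.1 hfg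
    exact (Int.pairwise_one_le_dist hx).trans (ContinuousMap.dist_apply_le_dist x)
  exact TopologicalSpace.separableSpace_iff_countable.1 inferInstance

end K0

/-- `(K⁰(X, h), K⁰(X, h)⁺)` is an ordered group (a countable abelian group with a
positive cone satisfying the three axioms), and `π(1)` is an order unit. -/
theorem stmt3 {X : Type*} [TopologicalSpace X] [CompactSpace X]
    [TopologicalSpace.MetrizableSpace X] [TotallyDisconnectedSpace X]
    (h : X ≃ₜ X) (Z : Set X) (ψ : X → X)
    (hfem : IsFiberwiseEssentiallyMinimal h Z ψ) :
    Countable (K0 h) ∧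
    (∀ a ∈ K0pos h, ∀ b ∈ K0pos h, a + b ∈ K0pos h) ∧
    (∀ g : K0 h, ∃ a ∈ K0pos h, ∃ b ∈ K0pos h, g = a - b) ∧
    (K0pos h ∩ (-(K0pos h)) = {0}) ∧
    (K0pi h 1 ∈ K0pos h ∧
      ∀ g ∈ K0pos h, ∃ n : ℕ, 0 < n ∧ n • K0pi h 1 - g ∈ K0pos h) := by
  refine ⟨?_, ?_, ?_, ?_, ?_, ?_⟩
  · have := ContinuousMap.countable_int (X := X)
    exact (K0pi_surjective h).countable
  · rintro _ ⟨f, hf, rfl⟩ _ ⟨g, hg, rfl⟩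
    exact ⟨f + g, fun x => add_nonneg (hf x) (hg x), map_add _ _ _⟩
  · intro g
    obtain ⟨f, rfl⟩ := K0pi_surjective h g
    refine ⟨_, ⟨f ⊔ 0, fun x => le_sup_right, rfl⟩, _, ⟨f ⊔ 0 - f, fun x => ?_, rfl⟩, ?_⟩
    · exact sub_nonneg.2 le_sup_left
    · rw [← map_sub, sub_sub_cancel]
  · refine Subset.antisymm ?_ ?_
    · rintro _ ⟨⟨f, hf, rfl⟩, g, hg, hgf⟩
      obtain ⟨u, hu⟩ := K0pi_eq_zero_iff.1
        (show K0pi h (f + g) = 0 by rw [map_add, hgf, add_neg_cancel])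
      have hsum : ∀ x, u x - u (h.symm x) = f x + g x := fun x => by
        rw [← coboundary_apply, hu]; rfl
      have hinv := hfem.apply_eq_of_le u fun x => by
        have h1 := hsum (h x)
        rw [h.symm_apply_apply] at h1
        linarith [hf (h x), hg (h x)]
      have hf0 : f = 0 := by
        ext x
        have h1 := hinv (h.symm x)
        rw [h.apply_symm_apply] at h1
        have h2 : f x = 0 := by linarith [hsum x, hf x, hg x]
        exact h2
      rw [hf0, map_zero]
      rfl
    · rintro _ rfl
      have h0 : (0 : K0 h) ∈ K0pos h := ⟨0, fun x => le_rfl, map_zero _⟩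
      exact ⟨h0, by rwa [Set.mem_neg, neg_zero]⟩
  · exact ⟨1, fun x => zero_le_one, rfl⟩
  · rintro _ ⟨f, hf, rfl⟩
    obtain ⟨b, hb⟩ := (isCompact_range f.continuous).bddAbove
    refine ⟨b.toNat + 1, Nat.succ_pos _, (b.toNat + 1) • 1 - f, fun x => ?_, ?_⟩
    · have h1 : f x ≤ b := hb (mem_range_self x)
      have h2 := Int.self_le_toNat b
      rw [ContinuousMap.sub_apply, ContinuousMap.nsmul_apply, ContinuousMap.one_apply,
        nsmul_eq_mul]
      push_cast
      linarith
    · rw [map_sub, map_nsmul]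
end

section
/- Let X be a compact, metrizable, totally disconnected topological space, let Z ⊆ X be closed, and let h₁, h₂ : X → X be homeomorphisms such that (X, h₁, Z) and (X, h₂, Z) are fiberwise essentially minimal zero-dimensional systems, such that h₁ and h₂ have the same orbits (for every x ∈ X, { h₁^n(x) : n ∈ ℤ } = { h₂^n(x) : n ∈ ℤ }), and such that there exist functions β, γ : X → ℤ, each continuous on X \ Z, with h₁(x) = h₂^{β(x)}(x) and h₂(x) = h₁^{γ(x)}(x) for all x ∈ X. Let C(X, ℤ) be the additive group of continuous ℤ-valued functions on X and let α₁, α₂ : C(X, ℤ) → C(X, ℤ) be the automorphisms α₁(f) = f ∘ h₁⁻¹ and α₂(f) = f ∘ h₂⁻¹. Then the subgroups im(id − α₁) and im(id − α₂) of C(X, ℤ) are equal. -/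
open Set

/-- The full `h`-orbit `{ hⁿ(x) : n ∈ ℤ }` of a point. -/
def Orbit {X : Type*} [TopologicalSpace X] (h : X ≃ₜ X) (x : X) : Set X :=
  { y | ∃ n : ℤ, y = (h.toEquiv ^ n) x }

/-- Every function of the form `g - g ∘ h⁻ⁿ` is a coboundary. -/
theorem exists_mem_range_coboundary_zpow {X : Type*} [TopologicalSpace X] (h : X ≃ₜ X)
    (n : ℤ) (g : C(X, ℤ)) :
    ∃ F ∈ (coboundary h).range, ∀ x, F x = g x - g ((h.toEquiv ^ (-n)) x) := by
  induction n using Int.induction_on generalizing g with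
  | zero => exact ⟨0, zero_mem _, fun x => by simp⟩
  | succ n ih =>
    obtain ⟨F, hF, hFx⟩ := ih (g.comp (h.symm : C(X, X)))
    refine ⟨F + coboundary h g, add_mem hF ⟨g, rfl⟩, fun x => ?_⟩
    have hpow : (h.toEquiv ^ (-((n : ℤ) + 1))) x = h.symm ((h.toEquiv ^ (-(n : ℤ))) x) := by
      rw [show -((n : ℤ) + 1) = -1 + -n by ring, zpow_add, zpow_neg_one]
      rfl
    rw [hpow, ContinuousMap.add_apply, hFx x]
    simp [coboundary]
  | pred n ih =>
    obtain ⟨F, hF, hFx⟩ := ih (g.comp (h : C(X, X)))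
    refine ⟨F - coboundary h (g.comp (h : C(X, X))), sub_mem hF ⟨_, rfl⟩, fun x => ?_⟩
    have hpow : (h.toEquiv ^ (-(-(n : ℤ) - 1))) x = h ((h.toEquiv ^ (-(-(n : ℤ)))) x) := by
      rw [show -(-(n : ℤ) - 1) = 1 + -(-(n : ℤ)) by ring, zpow_add, zpow_one]
      rfl
    rw [hpow, ContinuousMap.sub_apply, hFx x]
    simp [coboundary]

/-- If `h₁` is given on the support of `g` by powers of `h₂` whose exponent is continuous there,
then `g - g ∘ h₁⁻¹` is a coboundary for `h₂`. -/
theorem coboundary_mem_range_of_continuousOn_support {X : Type*} [TopologicalSpace X]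
    [CompactSpace X] (h₁ h₂ : X ≃ₜ X) (g : C(X, ℤ)) (β : X → ℤ)
    (hβ : ContinuousOn β {x | g x ≠ 0}) (hβeq : ∀ x, h₁ x = (h₂.toEquiv ^ β x) x) :
    coboundary h₁ g ∈ (coboundary h₂).range := by
  classical
  have hK : IsClopen {x | g x ≠ 0} := (isClopen_discrete {n : ℤ | n ≠ 0}).preimage g.continuous
  let b : X → ℤ := fun x => if g x ≠ 0 then β x else 0
  have hb : Continuous b := by
    refine continuous_if (fun a ha => ?_) ?_ continuousOn_const
    · rw [hK.frontier_eq] at ha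
      exact ha.elim
    · rwa [hK.isClosed.closure_eq]
  have hfin : (range b).Finite := (isCompact_range hb).finite_of_discrete
  let p : ℤ → C(X, ℤ) := fun n => ⟨fun x => g x * (if b x = n then 1 else 0),
    g.continuous.mul ((continuous_of_discreteTopology
      (f := fun m : ℤ => if m = n then (1 : ℤ) else 0)).comp hb)⟩
  choose F hF hFx using fun n => exists_mem_range_coboundary_zpow h₂ n (p n)
  suffices coboundary h₁ g = ∑ n ∈ hfin.toFinset, F n by
    rw [this]
    exact sum_mem fun n _ => hF n
  ext x
  have hterm : ∀ n, p n ((h₂.toEquiv ^ (-n)) x) =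
      if b (h₁.symm x) = n then g (h₁.symm x) else 0 := by
    intro n
    by_cases hv : g ((h₂.toEquiv ^ (-n)) x) ≠ 0 ∧ b ((h₂.toEquiv ^ (-n)) x) = n
    · obtain ⟨hv, hbv⟩ := hv
      have hβv : β ((h₂.toEquiv ^ (-n)) x) = n := (if_pos hv).symm.trans hbv
      have hw : h₁.symm x = (h₂.toEquiv ^ (-n)) x := by
        rw [Homeomorph.symm_apply_eq, hβeq, hβv, ← Equiv.Perm.mul_apply, ← zpow_add]
        simp
      rw [hw]
      simp only [p, ContinuousMap.coe_mk, hbv, if_true, mul_one]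
    · have hleft : p n ((h₂.toEquiv ^ (-n)) x) = 0 := by
        simp only [p, ContinuousMap.coe_mk, mul_ite, mul_one, mul_zero, ite_eq_right_iff]
        intro hbv
        by_contra hg
        exact hv ⟨hg, hbv⟩
      rw [hleft]
      split_ifs with hbw
      · by_contra hg
        have hg' : g (h₁.symm x) ≠ 0 := Ne.symm hg
        have hβw : β (h₁.symm x) = n := (if_pos hg').symm.trans hbw
        have hw : (h₂.toEquiv ^ (-n)) x = h₁.symm x := by
          rw [zpow_neg, Equiv.Perm.inv_eq_iff_eq, ← hβw, ← hβeq, Homeomorph.apply_symm_apply]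
        exact hv (hw ▸ ⟨hg', hbw⟩)
      · rfl
  have hmem : ∀ y, b y ∈ hfin.toFinset := fun y => by simp
  rw [ContinuousMap.sum_apply]
  simp only [hFx, hterm, Finset.sum_sub_distrib, Finset.sum_ite_eq, hmem, if_true]
  simp [p, coboundary]

theorem range_coboundary_le {X : Type*} [TopologicalSpace X] [CompactSpace X] (Z : Set X)
    (h₁ h₂ : X ≃ₜ X) (ψ : X → X) (hψ : Continuous ψ) (hψZ : ∀ z ∈ Z, ψ z = z)
    (hψh : ∀ x, ψ (h₁ x) = ψ x) (β : X → ℤ) (hβ : ContinuousOn β Zᶜ)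
    (hβeq : ∀ x, h₁ x = (h₂.toEquiv ^ β x) x) :
    (coboundary h₁).range ≤ (coboundary h₂).range := by
  rintro _ ⟨f, rfl⟩
  let g : C(X, ℤ) := f - f.comp ⟨ψ, hψ⟩
  have hfg : coboundary h₁ f = coboundary h₁ g := by
    ext x
    have hx : ψ (h₁.symm x) = ψ x := by rw [← hψh, Homeomorph.apply_symm_apply]
    simp [coboundary, g, hx]
  rw [hfg]
  refine coboundary_mem_range_of_continuousOn_support h₁ h₂ g β (hβ.mono ?_) hβeq
  intro x hx hxZ
  exact hx (by simp [g, hψZ x hxZ])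

/-- If two fiberwise essentially minimal systems on the same space with the same `Z`
have the same orbits, with orbit cocycles continuous off `Z`, then the subgroups
`im(id - α₁)` and `im(id - α₂)` of `C(X, ℤ)` coincide. -/
theorem stmt9 {X : Type*} [TopologicalSpace X] [CompactSpace X]
    [TopologicalSpace.MetrizableSpace X] [TotallyDisconnectedSpace X]
    (Z : Set X) (hZ : IsClosed Z)
    (h₁ h₂ : X ≃ₜ X) (ψ₁ ψ₂ : X → X)
    (hfem₁ : IsFiberwiseEssentiallyMinimal h₁ Z ψ₁)
    (hfem₂ : IsFiberwiseEssentiallyMinimal h₂ Z ψ₂)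
    (horb : ∀ x : X, Orbit h₁ x = Orbit h₂ x)
    (β γ : X → ℤ)
    (hβ : ContinuousOn β Zᶜ) (hγ : ContinuousOn γ Zᶜ)
    (hβeq : ∀ x : X, h₁ x = (h₂.toEquiv ^ β x) x)
    (hγeq : ∀ x : X, h₂ x = (h₁.toEquiv ^ γ x) x) :
    (coboundary h₁).range = (coboundary h₂).range := by
  obtain ⟨-, hψ₁, -, hψZ₁, hψh₁, -⟩ := hfem₁
  obtain ⟨-, hψ₂, -, hψZ₂, hψh₂, -⟩ := hfem₂
  exact le_antisymm (range_coboundary_le Z h₁ h₂ ψ₁ hψ₁ hψZ₁ hψh₁ β hβ hβeq)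
    (range_coboundary_le Z h₂ h₁ ψ₂ hψ₂ hψZ₂ hψh₂ γ hγ hγeq)
end
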